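/- Let f̌ : ℕ → ℍ be a coefficient sequence such that the power series f(q) = ∑_{n≥0} qⁿ f̌(n) converges for every q ∈ 𝔹. Then f belongs to H¹(𝔹) if and only if there exist four sequences f̌₁, f̌₂, ǧ₁, ǧ₂ : ℕ → ℍ, each with ∑_{n≥0} |·(n)|² < ∞, such that for every n ≥ 0, f̌(n) = ∑_{k=0}^{n} f̌₁(k)·f̌₂(n−k) + ∑_{k=0}^{n} ǧ₁(k)·ǧ₂(n−k); that is, H¹(𝔹) = H²(𝔹) ⋆ H²(𝔹) + H²(𝔹) ⋆ H²(𝔹). -/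

import Mathlib

open scoped Quaternion ENNReal
open MeasureTheory

/-- `e^{Iθ} = cos θ + I sin θ` for an imaginary unit `I`. -/
noncomputable def expQ (I : ℍ[ℝ]) (θ : ℝ) : ℍ[ℝ] := Real.cos θ • (1 : ℍ[ℝ]) + Real.sin θ • I

/-- Membership in the quaternionic Hardy space `H¹(𝔹)` for a regular function given by
its coefficient sequence `f̌`: the means `(1/2π)∫_{−π}^{π} |f(r e^{Iθ})| dθ` are bounded
uniformly in the imaginary unit `I` and in `0 < r < 1`. -/
def MemH1 (f : ℕ → ℍ[ℝ]) : Prop :=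
  ∃ M : ℝ, ∀ I : ℍ[ℝ], I.re = 0 → ‖I‖ = 1 → ∀ r : ℝ, 0 < r → r < 1 →
    (1 / (2 * Real.pi)) *
        ∫ θ in (-Real.pi)..Real.pi, ‖∑' n : ℕ, (r • expQ I θ) ^ n * f n‖ ≤ M


open Filter Topology Real in
/-- **Parseval's identity** for absolutely convergent trigonometric series with coefficients in a
real Hilbert space carrying an orthogonal complex structure `J`. -/
theorem hasSum_norm_sq_trigSeries {E : Type*} [NormedAddCommGroup E] [InnerProductSpace ℝ E]
    [CompleteSpace E] (J : E →L[ℝ] E) (hJ : ∀ x y, inner ℝ (J x) (J y) = inner ℝ x y)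
    (hJJ : ∀ x, J (J x) = -x) {c : ℕ → E} (hc : Summable fun n => ‖c n‖) :
    HasSum (fun n => ‖c n‖ ^ 2) ((1 / (2 * π)) *
      ∫ θ in (-π)..π, ‖∑' n : ℕ, (cos (n * θ) • c n + sin (n * θ) • J (c n))‖ ^ 2) := by
  have skew (x y : E) : inner ℝ (J x) y = - inner ℝ x (J y) := by
    rw [← hJ (J x) y, hJJ, inner_neg_left]
  have inner_e (α β : ℝ) (x y : E) :
      inner ℝ (cos α • x + sin α • J x) (cos β • y + sin β • J y) =
        cos (α - β) * inner ℝ x y + sin (α - β) * inner ℝ (J x) y := by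
    simp only [inner_add_left, inner_add_right, real_inner_smul_left, real_inner_smul_right, hJ,
      cos_sub, sin_sub, skew]
    ring
  have norm_e (α : ℝ) (x : E) : ‖cos α • x + sin α • J x‖ = ‖x‖ := by
    have := inner_e α α x x
    rw [sub_self, cos_zero, sin_zero, one_mul, zero_mul, add_zero, real_inner_self_eq_norm_sq,
      real_inner_self_eq_norm_sq] at this
    exact (sq_eq_sq₀ (norm_nonneg _) (norm_nonneg _)).1 this
  have int_cos (m n : ℕ) (h : m ≠ n) : ∫ θ in (-π)..π, cos (m * θ - n * θ) = 0 := by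
    have h' : (m : ℝ) - n ≠ 0 := sub_ne_zero.2 (by exact_mod_cast h)
    simp_rw [← sub_mul]
    rw [intervalIntegral.integral_comp_mul_left _ h', integral_cos,
      show (m : ℝ) - n = ((m - n : ℤ) : ℝ) by push_cast; rfl, sin_int_mul_pi, mul_neg, sin_neg,
      sin_int_mul_pi]
    simp
  have int_sin (m n : ℕ) : ∫ θ in (-π)..π, sin (m * θ - n * θ) = 0 := by
    by_cases h : m = n
    · simp [h]
    have h' : (m : ℝ) - n ≠ 0 := sub_ne_zero.2 (by exact_mod_cast h)
    simp_rw [← sub_mul]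
    rw [intervalIntegral.integral_comp_mul_left _ h', integral_sin]
    simp
  set e : ℕ → ℝ → E := fun n θ => cos (n * θ) • c n + sin (n * θ) • J (c n) with he
  have cont_e (n : ℕ) : Continuous (e n) := by fun_prop
  have norm_en (n : ℕ) (θ : ℝ) : ‖e n θ‖ = ‖c n‖ := norm_e _ _
  have ortho (m n : ℕ) (h : m ≠ n) : ∫ θ in (-π)..π, inner ℝ (e m θ) (e n θ) = 0 := by
    simp only [he, inner_e]
    rw [intervalIntegral.integral_add (by apply Continuous.intervalIntegrable; fun_prop)
      (by apply Continuous.intervalIntegrable; fun_prop), intervalIntegral.integral_mul_const,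
      intervalIntegral.integral_mul_const, int_cos m n h, int_sin]
    simp
  have partial_sum (N : ℕ) : ∫ θ in (-π)..π, ‖∑ n ∈ Finset.range N, e n θ‖ ^ 2 =
      2 * π * ∑ n ∈ Finset.range N, ‖c n‖ ^ 2 := by
    induction N with
    | zero => simp
    | succ N ih =>
      simp_rw [Finset.sum_range_succ, norm_add_sq_real, norm_en, sum_inner]
      rw [intervalIntegral.integral_add, intervalIntegral.integral_add, ih,
        intervalIntegral.integral_const_mul, intervalIntegral.integral_finsetSum,
        Finset.sum_eq_zero (fun n hn => ortho n N (Finset.mem_range.1 hn).ne), intervalIntegral.integral_const]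
      · simp only [smul_eq_mul]; ring
      all_goals intros; apply Continuous.intervalIntegrable; fun_prop
  rw [hasSum_iff_tendsto_nat_of_nonneg (fun _ => by positivity)]
  have key : Tendsto (fun N => ∫ θ in (-π)..π, ‖∑ n ∈ Finset.range N, e n θ‖ ^ 2) atTop
      (𝓝 (∫ θ in (-π)..π, ‖∑' n, e n θ‖ ^ 2)) := by
    apply intervalIntegral.tendsto_integral_filter_of_dominated_convergence
      (fun _ => (∑' n, ‖c n‖) ^ 2)
    · exact Eventually.of_forall fun N => by
        apply Continuous.aestronglyMeasurable; fun_prop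
    · refine Eventually.of_forall fun N => Eventually.of_forall fun θ _ => ?_
      rw [norm_pow, norm_norm]
      gcongr
      refine (norm_sum_le _ _).trans ?_
      simp only [norm_en]
      exact hc.sum_le_tsum _ fun _ _ => norm_nonneg _
    · simp
    · refine Eventually.of_forall fun θ _ => ?_
      have : Summable fun n => e n θ := Summable.of_norm (by simpa only [norm_en] using hc)
      exact (this.hasSum.tendsto_sum_nat.norm).pow 2
  refine (key.const_mul (1 / (2 * π))).congr fun N => ?_
  rw [partial_sum]
  field_simp

section QuaternionicSlices

open Real

variable {I : ℍ[ℝ]}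

theorem imaginaryUnit_mul_self (hre : I.re = 0) (hI : ‖I‖ = 1) : I * I = -1 := by
  have h : star I = -I := Quaternion.star_eq_neg.2 hre
  have := Quaternion.self_mul_star I
  rw [h, Quaternion.normSq_eq_norm_mul_self, hI, mul_neg] at this
  rw [← neg_eq_iff_eq_neg, this]
  simp

theorem expQ_zero (I : ℍ[ℝ]) : expQ I 0 = 1 := by simp [expQ]

theorem expQ_add (hre : I.re = 0) (hI : ‖I‖ = 1) (α β : ℝ) :
    expQ I (α + β) = expQ I α * expQ I β := by
  simp only [expQ, cos_add, sin_add, add_mul, mul_add, smul_mul_assoc, mul_smul_comm, one_mul,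
    mul_one, imaginaryUnit_mul_self hre hI]
  module

theorem expQ_pow (hre : I.re = 0) (hI : ‖I‖ = 1) (θ : ℝ) (n : ℕ) :
    expQ I θ ^ n = expQ I (n * θ) := by
  induction n with
  | zero => simp [expQ_zero]
  | succ n ih => rw [pow_succ, ih, ← expQ_add hre hI]; push_cast; ring_nf

theorem norm_expQ (hre : I.re = 0) (hI : ‖I‖ = 1) (θ : ℝ) : ‖expQ I θ‖ = 1 := by
  have h2 : star (expQ I θ) = expQ I (-θ) := by
    simp [expQ, Quaternion.star_eq_neg.2 hre]
  have := Quaternion.self_mul_star (expQ I θ)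
  rw [h2, ← expQ_add hre hI, add_neg_cancel, expQ_zero, Quaternion.normSq_eq_norm_mul_self] at this
  have h3 : ‖expQ I θ‖ * ‖expQ I θ‖ = 1 :=
    (Quaternion.coe_injective (Quaternion.coe_one.trans this)).symm
  nlinarith [norm_nonneg (expQ I θ)]

theorem norm_smul_expQ_pow_mul (hre : I.re = 0) (hI : ‖I‖ = 1) {r : ℝ} (hr : 0 ≤ r) (θ : ℝ)
    (n : ℕ) (x : ℍ[ℝ]) : ‖(r • expQ I θ) ^ n * x‖ = r ^ n * ‖x‖ := by
  rw [norm_mul, norm_pow, norm_smul, norm_expQ hre hI, mul_one, norm_of_nonneg hr]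

theorem continuous_expQ (I : ℍ[ℝ]) : Continuous (expQ I) := by
  unfold expQ; fun_prop

theorem continuous_tsum_slice (hre : I.re = 0) (hI : ‖I‖ = 1) {r : ℝ} (hr : 0 ≤ r) {c : ℕ → ℍ[ℝ]}
    (hc : Summable fun n => r ^ n * ‖c n‖) :
    Continuous fun θ => ∑' n : ℕ, (r • expQ I θ) ^ n * c n := by
  have := continuous_expQ I
  exact continuous_tsum (fun n => by fun_prop) hc
    fun n θ => (norm_smul_expQ_pow_mul hre hI hr θ n _).le

theorem hasSum_norm_sq_slice (hre : I.re = 0) (hI : ‖I‖ = 1) {r : ℝ} (hr : 0 ≤ r) {c : ℕ → ℍ[ℝ]}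
    (hc : Summable fun n => r ^ n * ‖c n‖) :
    HasSum (fun n => (r ^ n * ‖c n‖) ^ 2)
      ((1 / (2 * π)) * ∫ θ in (-π)..π, ‖∑' n : ℕ, (r • expQ I θ) ^ n * c n‖ ^ 2) := by
  have h := hasSum_norm_sq_trigSeries (ContinuousLinearMap.mul ℝ ℍ[ℝ] I) (c := fun n => r ^ n • c n)
    (fun x y => by
      simp only [ContinuousLinearMap.mul_apply', real_inner_eq_norm_add_mul_self_sub_norm_mul_self_sub_norm_mul_self_div_two,
        ← mul_add, norm_mul, hI, one_mul])
    (fun x => by simp [← mul_assoc, imaginaryUnit_mul_self hre hI])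
    (by simpa [norm_smul, abs_of_nonneg hr] using hc)
  convert h using 1
  · simp [norm_smul, abs_of_nonneg hr]
  · have (θ : ℝ) (n : ℕ) : (r • expQ I θ) ^ n * c n = cos (n * θ) • r ^ n • c n +
        sin (n * θ) • ContinuousLinearMap.mul ℝ ℍ[ℝ] I (r ^ n • c n) := by
      rw [smul_pow, expQ_pow hre hI, expQ]
      simp [add_mul, smul_comm (r ^ n)]
    simp only [this]

theorem summable_pow_mul_norm {r : ℝ} (hr : 0 ≤ r) (hr1 : r < 1) {c : ℕ → ℍ[ℝ]}
    (hc : Summable fun n => ‖c n‖ ^ 2) : Summable fun n => r ^ n * ‖c n‖ := by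
  refine .of_nonneg_of_le (fun n => by positivity) (fun n => ?_)
    ((summable_geometric_of_lt_one (sq_nonneg r) (by nlinarith : r ^ 2 < 1)).add hc)
  rw [← pow_mul, mul_comm 2, pow_mul]
  nlinarith [sq_nonneg (r ^ n - ‖c n‖), sq_nonneg (r ^ n + ‖c n‖)]

theorem mean_norm_sq_slice_le (hre : I.re = 0) (hI : ‖I‖ = 1) {r : ℝ} (hr : 0 ≤ r) (hr1 : r < 1)
    {c : ℕ → ℍ[ℝ]} (hc : Summable fun n => ‖c n‖ ^ 2) :
    (1 / (2 * π)) * ∫ θ in (-π)..π, ‖∑' n : ℕ, (r • expQ I θ) ^ n * c n‖ ^ 2 ≤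
      ∑' n, ‖c n‖ ^ 2 := by
  have h := hasSum_norm_sq_slice hre hI hr (summable_pow_mul_norm hr hr1 hc)
  refine hasSum_le (fun n => ?_) h hc.hasSum
  gcongr
  exact mul_le_of_le_one_left (norm_nonneg _) (pow_le_one₀ hr hr1.le)

/-- On the slice of `I`, the `⋆`-product splits along the decomposition of the left factor into
the parts commuting and anticommuting with `I`. -/
theorem tsum_slice_starProduct (hre : I.re = 0) (hI : ‖I‖ = 1) {r : ℝ} (hr : 0 ≤ r)
    {a b g : ℕ → ℍ[ℝ]} (ha : Summable fun n => r ^ n * ‖a n‖)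
    (hb : Summable fun n => r ^ n * ‖b n‖) (hg : Summable fun n => r ^ n * ‖g n‖)
    (haI : ∀ n, a n * I = I * a n) (hbI : ∀ n, b n * I = -(I * b n)) (θ : ℝ) :
    HasSum (fun n => (r • expQ I θ) ^ n * ∑ k ∈ Finset.range (n + 1), (a k + b k) * g (n - k))
      ((∑' n, (r • expQ I θ) ^ n * a n) * (∑' n, (r • expQ I θ) ^ n * g n) +
        (∑' n, (r • expQ I θ) ^ n * b n) * (∑' n, (r • expQ (-I) θ) ^ n * g n)) := by
  have hre' : (-I).re = 0 := by simpa using hre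
  have hI' : ‖-I‖ = 1 := by simpa using hI
  have s {J : ℍ[ℝ]} (hre : J.re = 0) (hJ : ‖J‖ = 1) {c : ℕ → ℍ[ℝ]}
      (hc : Summable fun n => r ^ n * ‖c n‖) : Summable fun n => ‖(r • expQ J θ) ^ n * c n‖ := by
    simpa only [norm_smul_expQ_pow_mul hre hJ hr] using hc
  have commA (n k : ℕ) : a k * (r • expQ I θ) ^ n = (r • expQ I θ) ^ n * a k := by
    rw [smul_pow, expQ_pow hre hI, expQ]
    simp [mul_add, add_mul, haI]
  have commB (n k : ℕ) : b k * (r • expQ (-I) θ) ^ n = (r • expQ I θ) ^ n * b k := by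
    rw [smul_pow, smul_pow, expQ_pow hre hI, expQ_pow hre' hI', expQ, expQ]
    simp [mul_add, add_mul, hbI]
  have h1 := (summable_norm_sum_mul_range_of_summable_norm (s hre hI ha) (s hre hI hg)).of_norm.hasSum
  have h2 := (summable_norm_sum_mul_range_of_summable_norm (s hre hI hb)
    (s hre' hI' hg)).of_norm.hasSum
  rw [← tsum_mul_tsum_eq_tsum_sum_range_of_summable_norm (s hre hI ha) (s hre hI hg)] at h1
  rw [← tsum_mul_tsum_eq_tsum_sum_range_of_summable_norm (s hre hI hb) (s hre' hI' hg)] at h2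
  refine (h1.add h2).congr_fun fun n => ?_
  rw [← Finset.sum_add_distrib, Finset.mul_sum]
  refine Finset.sum_congr rfl fun k hk => ?_
  have hn : n = k + (n - k) := by have := Finset.mem_range.1 hk; omega
  have hA : (r • expQ I θ) ^ k * a k * ((r • expQ I θ) ^ (n - k) * g (n - k)) =
      (r • expQ I θ) ^ n * (a k * g (n - k)) := by
    rw [mul_assoc, ← mul_assoc (a k), commA, mul_assoc, ← mul_assoc, ← pow_add, ← hn]
  have hB : (r • expQ I θ) ^ k * b k * ((r • expQ (-I) θ) ^ (n - k) * g (n - k)) =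
      (r • expQ I θ) ^ n * (b k * g (n - k)) := by
    rw [mul_assoc, ← mul_assoc (b k), commB, mul_assoc, ← mul_assoc, ← pow_add, ← hn]
  rw [hA, hB, add_mul, mul_add]

theorem mean_norm_mul_add_mul_le {A B G H : ℝ → ℍ[ℝ]} (hA : Continuous A) (hB : Continuous B)
    (hG : Continuous G) (hH : Continuous H) :
    (1 / (2 * π)) * ∫ θ in (-π)..π, ‖A θ * G θ + B θ * H θ‖ ≤
      ((1 / (2 * π)) * (∫ θ in (-π)..π, ‖A θ‖ ^ 2) + (1 / (2 * π)) * (∫ θ in (-π)..π, ‖B θ‖ ^ 2) +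
        (1 / (2 * π)) * (∫ θ in (-π)..π, ‖G θ‖ ^ 2) +
        (1 / (2 * π)) * ∫ θ in (-π)..π, ‖H θ‖ ^ 2) / 2 := by
  have hle : ∫ θ in (-π)..π, ‖A θ * G θ + B θ * H θ‖ ≤
      ∫ θ in (-π)..π, (‖A θ‖ ^ 2 + ‖B θ‖ ^ 2 + ‖G θ‖ ^ 2 + ‖H θ‖ ^ 2) / 2 := by
    apply intervalIntegral.integral_mono_on (by linarith [pi_pos])
    · apply Continuous.intervalIntegrable; fun_prop
    · apply Continuous.intervalIntegrable; fun_prop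
    · intro θ _
      refine (norm_add_le _ _).trans ?_
      rw [norm_mul, norm_mul]
      nlinarith [sq_nonneg (‖A θ‖ - ‖G θ‖), sq_nonneg (‖B θ‖ - ‖H θ‖)]
  rw [intervalIntegral.integral_div, intervalIntegral.integral_add, intervalIntegral.integral_add,
    intervalIntegral.integral_add] at hle
  · refine (mul_le_mul_of_nonneg_left hle (by positivity)).trans_eq ?_
    ring
  all_goals apply Continuous.intervalIntegrable; fun_prop

/-- The `L¹` means of a `⋆`-product of two `H²` functions are bounded on every slice. -/
theorem mean_norm_starProduct_le (hre : I.re = 0) (hI : ‖I‖ = 1) {r : ℝ} (hr : 0 ≤ r) (hr1 : r < 1)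
    {f g : ℕ → ℍ[ℝ]} (hf : Summable fun n => ‖f n‖ ^ 2) (hg : Summable fun n => ‖g n‖ ^ 2) :
    ∃ F : ℝ → ℍ[ℝ], Continuous F ∧
      (∀ θ, HasSum (fun n => (r • expQ I θ) ^ n * ∑ k ∈ Finset.range (n + 1), f k * g (n - k))
        (F θ)) ∧
      (1 / (2 * π)) * ∫ θ in (-π)..π, ‖F θ‖ ≤ ∑' n, ‖f n‖ ^ 2 + ∑' n, ‖g n‖ ^ 2 := by
  have hre' : (-I).re = 0 := by simpa using hre
  have hI' : ‖-I‖ = 1 := by simpa using hI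
  have hII := imaginaryUnit_mul_self hre hI
  set a : ℕ → ℍ[ℝ] := fun n => (1 / 2 : ℝ) • (f n - I * f n * I) with ha
  set b : ℕ → ℍ[ℝ] := fun n => (1 / 2 : ℝ) • (f n + I * f n * I) with hb
  have hab (n : ℕ) : f n = a n + b n := by simp only [ha, hb]; module
  have haI (n : ℕ) : a n * I = I * a n := by
    simp only [ha, smul_mul_assoc, mul_smul_comm, sub_mul, mul_sub]
    rw [mul_assoc _ I I, hII, ← mul_assoc I (I * f n), ← mul_assoc I I, hII]
    simp only [mul_neg, neg_mul, mul_one, one_mul]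
    module
  have hbI (n : ℕ) : b n * I = -(I * b n) := by
    simp only [hb, smul_mul_assoc, mul_smul_comm, add_mul, mul_add]
    rw [mul_assoc _ I I, hII, ← mul_assoc I (I * f n), ← mul_assoc I I, hII]
    simp only [mul_neg, neg_mul, mul_one, one_mul]
    module
  have norm_IfI (n : ℕ) : ‖I * f n * I‖ = ‖f n‖ := by simp [hI]
  have norm_a (n : ℕ) : ‖a n‖ ≤ ‖f n‖ := by
    have := norm_sub_le (f n) (I * f n * I)
    rw [norm_IfI] at this
    rw [ha, norm_smul]; norm_num; linarith
  have norm_b (n : ℕ) : ‖b n‖ ≤ ‖f n‖ := by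
    have := norm_add_le (f n) (I * f n * I)
    rw [norm_IfI] at this
    rw [hb, norm_smul]; norm_num; linarith
  have le_a (n : ℕ) : ‖a n‖ ^ 2 ≤ ‖f n‖ ^ 2 := by gcongr; exact norm_a n
  have le_b (n : ℕ) : ‖b n‖ ^ 2 ≤ ‖f n‖ ^ 2 := by gcongr; exact norm_b n
  have sa : Summable fun n => ‖a n‖ ^ 2 := .of_nonneg_of_le (fun _ => by positivity) le_a hf
  have sb : Summable fun n => ‖b n‖ ^ 2 := .of_nonneg_of_le (fun _ => by positivity) le_b hf
  have ca := continuous_tsum_slice hre hI hr (summable_pow_mul_norm hr hr1 sa)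
  have cb := continuous_tsum_slice hre hI hr (summable_pow_mul_norm hr hr1 sb)
  have cg := continuous_tsum_slice hre hI hr (summable_pow_mul_norm hr hr1 hg)
  have cg' := continuous_tsum_slice hre' hI' hr (summable_pow_mul_norm hr hr1 hg)
  have ma := (mean_norm_sq_slice_le hre hI hr hr1 sa).trans (sa.tsum_le_tsum le_a hf)
  have mb := (mean_norm_sq_slice_le hre hI hr hr1 sb).trans (sb.tsum_le_tsum le_b hf)
  have mg := mean_norm_sq_slice_le hre hI hr hr1 hg
  have mg' := mean_norm_sq_slice_le hre' hI' hr hr1 hg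
  refine ⟨fun θ => (∑' n, (r • expQ I θ) ^ n * a n) * (∑' n, (r • expQ I θ) ^ n * g n) +
    (∑' n, (r • expQ I θ) ^ n * b n) * (∑' n, (r • expQ (-I) θ) ^ n * g n), ?_, fun θ => ?_, ?_⟩
  · exact (ca.mul cg).add (cb.mul cg')
  · simp only [hab]
    exact tsum_slice_starProduct hre hI hr (summable_pow_mul_norm hr hr1 sa)
      (summable_pow_mul_norm hr hr1 sb) (summable_pow_mul_norm hr hr1 hg) haI hbI θ
  · have := mean_norm_mul_add_mul_le ca cb cg cg'
    linarith

theorem memH1_of_sum_of_two_star_products {f f₁ f₂ g₁ g₂ : ℕ → ℍ[ℝ]}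
    (hf₁ : Summable fun n => ‖f₁ n‖ ^ 2) (hf₂ : Summable fun n => ‖f₂ n‖ ^ 2)
    (hg₁ : Summable fun n => ‖g₁ n‖ ^ 2) (hg₂ : Summable fun n => ‖g₂ n‖ ^ 2)
    (h : ∀ n : ℕ, f n = (∑ k ∈ Finset.range (n + 1), f₁ k * f₂ (n - k)) +
      (∑ k ∈ Finset.range (n + 1), g₁ k * g₂ (n - k))) : MemH1 f := by
  refine ⟨(∑' n, ‖f₁ n‖ ^ 2 + ∑' n, ‖f₂ n‖ ^ 2) + (∑' n, ‖g₁ n‖ ^ 2 + ∑' n, ‖g₂ n‖ ^ 2),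
    fun I hre hI r hr hr1 => ?_⟩
  obtain ⟨F, hF, hFs, hFle⟩ := mean_norm_starProduct_le hre hI hr.le hr1 hf₁ hf₂
  obtain ⟨G, hG, hGs, hGle⟩ := mean_norm_starProduct_le hre hI hr.le hr1 hg₁ hg₂
  have hsum (θ : ℝ) : ∑' n, (r • expQ I θ) ^ n * f n = F θ + G θ := by
    simp only [h, mul_add]
    exact ((hFs θ).add (hGs θ)).tsum_eq
  simp only [hsum]
  refine le_trans ?_ (add_le_add hFle hGle)
  rw [← mul_add, ← intervalIntegral.integral_add (hF.norm.intervalIntegrable _ _)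
    (hG.norm.intervalIntegrable _ _)]
  have := pi_pos
  gcongr
  exact intervalIntegral.integral_mono_on (by linarith)
    ((hF.add hG).norm.intervalIntegrable _ _) ((hF.norm.add hG.norm).intervalIntegrable _ _)
    fun θ _ => norm_add_le _ _

end QuaternionicSlices

section RieszFactorization

open Real Polynomial Filter Topology Metric

theorem sq_cpow_half (w : ℂ) : (w ^ (1 / 2 : ℂ)) ^ 2 = w := by
  simp

theorem one_add_mul_mem_slitPlane {b z : ℂ} (hb : ‖b‖ ≤ 1) (hz : ‖z‖ < 1) :
    1 + b * z ∈ Complex.slitPlane := by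
  left
  have h1 : |(b * z).re| ≤ ‖b * z‖ := Complex.abs_re_le_norm _
  have h2 : ‖b * z‖ < 1 := by
    rw [norm_mul]; nlinarith [norm_nonneg b, norm_nonneg z]
  have := abs_lt.1 (h1.trans_lt h2)
  simp only [Complex.add_re, Complex.one_re]
  linarith

theorem normSq_one_add_conj_mul_sub (a z : ℂ) :
    Complex.normSq (1 + starRingEnd ℂ a * z) - Complex.normSq (z + a) =
      (1 - Complex.normSq z) * (1 - Complex.normSq a) := by
  simp [Complex.normSq_apply]
  ring

/-- Every complex polynomial factors on the unit disc as a function bounded by one times a square,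
where the square is a polynomial with the same modulus on the unit circle. -/
theorem exists_inner_outer (P : ℂ[X]) : ∃ (B g : ℂ → ℂ) (Q : ℂ[X]),
    DifferentiableOn ℂ B (ball 0 1) ∧ DifferentiableOn ℂ g (ball 0 1) ∧
    (∀ z ∈ ball (0 : ℂ) 1, ‖B z‖ ≤ 1) ∧ (∀ z ∈ ball (0 : ℂ) 1, P.eval z = B z * g z ^ 2) ∧
    (∀ z ∈ ball (0 : ℂ) 1, Q.eval z = g z ^ 2) ∧ ∀ z, ‖z‖ = 1 → ‖Q.eval z‖ = ‖P.eval z‖ := by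
  have hP := IsAlgClosed.splits P
  induction hP using Submonoid.closure_induction with
  | one => exact ⟨1, 1, 1, by fun_prop, by fun_prop, by simp, by simp, by simp, by simp⟩
  | mul P₁ P₂ _ _ h₁ h₂ =>
    obtain ⟨B₁, g₁, Q₁, hB₁, hg₁, hn₁, hP₁, hQ₁, hc₁⟩ := h₁
    obtain ⟨B₂, g₂, Q₂, hB₂, hg₂, hn₂, hP₂, hQ₂, hc₂⟩ := h₂
    refine ⟨fun z => B₁ z * B₂ z, fun z => g₁ z * g₂ z, Q₁ * Q₂, hB₁.mul hB₂, hg₁.mul hg₂,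
      fun z hz => ?_, fun z hz => ?_, fun z hz => ?_, fun z hz => ?_⟩
    · rw [norm_mul]; exact mul_le_one₀ (hn₁ z hz) (norm_nonneg _) (hn₂ z hz)
    · rw [eval_mul, hP₁ z hz, hP₂ z hz]; ring
    · rw [eval_mul, hQ₁ z hz, hQ₂ z hz]; ring
    · rw [eval_mul, eval_mul, norm_mul, norm_mul, hc₁ z hz, hc₂ z hz]
  | mem P hP =>
    rcases hP with ⟨a, rfl⟩ | ⟨a, rfl⟩
    · exact ⟨1, fun _ => a ^ (1 / 2 : ℂ), C a, by fun_prop, by fun_prop, by simp,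
        fun z _ => by simp only [sq_cpow_half]; simp,
        fun z _ => by simp only [sq_cpow_half]; simp, by simp⟩
    · rcases lt_or_ge ‖a‖ 1 with ha | ha
      · have hs (z : ℂ) (hz : z ∈ ball (0 : ℂ) 1) : 1 + starRingEnd ℂ a * z ∈ Complex.slitPlane :=
          one_add_mul_mem_slitPlane (by simpa using ha.le) (by simpa using hz)
        have ha2 : Complex.normSq a ≤ 1 := by
          rw [Complex.normSq_eq_norm_sq]; exact pow_le_one₀ (norm_nonneg _) ha.le
        refine ⟨fun z => (z + a) / (1 + starRingEnd ℂ a * z),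
          fun z => (1 + starRingEnd ℂ a * z) ^ (1 / 2 : ℂ), 1 + C (starRingEnd ℂ a) * X,
          ?_, ?_, fun z hz => ?_, fun z hz => ?_, fun z hz => ?_, fun z hz => ?_⟩
        · exact DifferentiableOn.div (by fun_prop) (by fun_prop)
            fun z hz => Complex.slitPlane_ne_zero (hs z hz)
        · exact DifferentiableOn.cpow (by fun_prop) (by fun_prop) hs
        · rw [norm_div]
          refine div_le_one_of_le₀ ?_ (norm_nonneg _)
          rw [← sq_le_sq₀ (norm_nonneg _) (norm_nonneg _), ← Complex.normSq_eq_norm_sq,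
            ← Complex.normSq_eq_norm_sq, ← sub_nonneg, normSq_one_add_conj_mul_sub]
          have hz2 : Complex.normSq z ≤ 1 := by
            rw [Complex.normSq_eq_norm_sq]
            exact pow_le_one₀ (norm_nonneg _) (mem_ball_zero_iff.1 hz).le
          exact mul_nonneg (by linarith) (by linarith)
        · have := Complex.slitPlane_ne_zero (hs z hz)
          rw [sq_cpow_half, div_mul_cancel₀ _ this]; simp
        · rw [sq_cpow_half]; simp
        · have h := normSq_one_add_conj_mul_sub a z
          rw [Complex.normSq_eq_norm_sq z, hz, one_pow, sub_self, zero_mul, sub_eq_zero,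
            Complex.normSq_eq_norm_sq, Complex.normSq_eq_norm_sq,
            sq_eq_sq₀ (norm_nonneg _) (norm_nonneg _)] at h
          simpa using h
      · have ha0 : a ≠ 0 := norm_pos_iff.1 (by linarith)
        refine ⟨1, fun z => a ^ (1 / 2 : ℂ) * (1 + a⁻¹ * z) ^ (1 / 2 : ℂ), X + C a, by fun_prop, ?_,
          by simp, fun z hz => ?_, fun z hz => ?_, fun z _ => rfl⟩
        · refine (differentiableOn_const _).mul (DifferentiableOn.cpow (by fun_prop) (by fun_prop)
            fun z hz => one_add_mul_mem_slitPlane ?_ (by simpa using hz))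
          rw [norm_inv]; exact inv_le_one_of_one_le₀ ha
        all_goals
          rw [mul_pow, sq_cpow_half, sq_cpow_half]
          simp only [eval_add, eval_X, eval_C, Pi.one_apply]
          field_simp
          ring

theorem hasSum_norm_sq_circleMap {r : ℝ} (hr : 0 ≤ r) {c : ℕ → ℂ}
    (hc : Summable fun n => r ^ n * ‖c n‖) :
    HasSum (fun n => (r ^ n * ‖c n‖) ^ 2)
      ((1 / (2 * π)) * ∫ θ in (-π)..π, ‖∑' n : ℕ, circleMap 0 r θ ^ n * c n‖ ^ 2) := by
  have h := hasSum_norm_sq_trigSeries (ContinuousLinearMap.mul ℝ ℂ Complex.I)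
    (c := fun n => (r : ℂ) ^ n * c n)
    (fun x y => by simp [Complex.inner])
    (fun x => by simp [← mul_assoc])
    (by simpa [abs_of_nonneg hr] using hc)
  convert h using 1
  · simp [abs_of_nonneg hr]
  · have (θ : ℝ) (n : ℕ) : circleMap 0 r θ ^ n * c n = cos (n * θ) • ((r : ℂ) ^ n * c n) +
        sin (n * θ) • ContinuousLinearMap.mul ℝ ℂ Complex.I ((r : ℂ) ^ n * c n) := by
      rw [circleMap_zero, mul_pow, ← Complex.exp_nat_mul, ← mul_assoc, Complex.exp_mul_I]
      simp
      ring
    simp only [this]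

/-- The `n`-th Taylor coefficient at the origin. -/
noncomputable def taylorCoeffZero (h : ℂ → ℂ) (n : ℕ) : ℂ :=
  (n.factorial : ℂ)⁻¹ * iteratedDeriv n h 0

theorem hasSum_taylorCoeffZero {h : ℂ → ℂ} (hh : DifferentiableOn ℂ h (ball 0 1)) {z : ℂ}
    (hz : z ∈ ball (0 : ℂ) 1) : HasSum (fun n => z ^ n * taylorCoeffZero h n) (h z) := by
  refine (Complex.hasSum_taylorSeries_on_ball hh hz).congr_fun fun n => ?_
  simp [taylorCoeffZero]
  ring

theorem taylorCoeffZero_mul {f g : ℂ → ℂ} (hf : DifferentiableOn ℂ f (ball 0 1))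
    (hg : DifferentiableOn ℂ g (ball 0 1)) (n : ℕ) :
    taylorCoeffZero (fun z => f z * g z) n =
      ∑ k ∈ Finset.range (n + 1), taylorCoeffZero f k * taylorCoeffZero g (n - k) := by
  have hb : ball (0 : ℂ) 1 ∈ 𝓝 0 := ball_mem_nhds _ one_pos
  rw [taylorCoeffZero, iteratedDeriv_fun_mul (hf.analyticAt hb).contDiffAt
    (hg.analyticAt hb).contDiffAt, Finset.mul_sum]
  refine Finset.sum_congr rfl fun k hk => ?_
  have hk : k ≤ n := by have := Finset.mem_range.1 hk; omega
  have h1 : (n.factorial : ℂ) ≠ 0 := by exact_mod_cast n.factorial_ne_zero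
  have h2 : (k.factorial : ℂ) ≠ 0 := by exact_mod_cast k.factorial_ne_zero
  have h3 : ((n - k).factorial : ℂ) ≠ 0 := by exact_mod_cast (n - k).factorial_ne_zero
  rw [taylorCoeffZero, taylorCoeffZero, Nat.cast_choose ℂ hk]
  field_simp

theorem iteratedDeriv_polynomial_eval (P : ℂ[X]) (n : ℕ) :
    iteratedDeriv n (fun z => P.eval z) = fun z => (derivative^[n] P).eval z := by
  induction n with
  | zero => simp
  | succ n ih =>
    rw [iteratedDeriv_succ, ih, Function.iterate_succ_apply']
    ext z
    exact Polynomial.deriv _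

theorem taylorCoeffZero_polynomial (P : ℂ[X]) (n : ℕ) :
    taylorCoeffZero (fun z => P.eval z) n = P.coeff n := by
  have h1 : (n.factorial : ℂ) ≠ 0 := by exact_mod_cast n.factorial_ne_zero
  rw [taylorCoeffZero, iteratedDeriv_polynomial_eval]
  simp only [← coeff_zero_eq_eval_zero, coeff_iterate_derivative, zero_add, Nat.descFactorial_self,
    nsmul_eq_mul]
  field_simp

/-- If `|h|²` is dominated on the disc by the modulus of a polynomial, then the `ℓ²` norm of the
Taylor coefficients of `h` is controlled by the `L¹` norm of the polynomial on the circle. -/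
theorem sum_sq_taylorCoeffZero_le {h : ℂ → ℂ} (hh : DifferentiableOn ℂ h (ball 0 1)) (Q : ℂ[X])
    (hQ : ∀ z ∈ ball (0 : ℂ) 1, ‖h z‖ ^ 2 ≤ ‖Q.eval z‖) (N : ℕ) :
    ∑ n ∈ Finset.range N, ‖taylorCoeffZero h n‖ ^ 2 ≤
      (1 / (2 * π)) * ∫ θ in (-π)..π, ‖Q.eval (circleMap 0 1 θ)‖ := by
  have cont_Q : Continuous fun p : ℝ × ℝ => ‖Q.eval (circleMap 0 p.1 p.2)‖ := by
    unfold circleMap; fun_prop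
  have hle : ∀ r ∈ Set.Ioo (0 : ℝ) 1, ∑ n ∈ Finset.range N, (r ^ n * ‖taylorCoeffZero h n‖) ^ 2 ≤
      (1 / (2 * π)) * ∫ θ in (-π)..π, ‖Q.eval (circleMap 0 r θ)‖ := by
    intro r hr
    have hmem (θ : ℝ) : circleMap 0 r θ ∈ ball (0 : ℂ) 1 := by
      simpa [abs_of_pos hr.1] using hr.2
    have hs : Summable fun n => r ^ n * ‖taylorCoeffZero h n‖ := by
      have := (hasSum_taylorCoeffZero hh (z := r) (by simpa [abs_of_pos hr.1] using hr.2)).summable.norm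
      simpa [abs_of_pos hr.1] using this
    have hP := hasSum_norm_sq_circleMap hr.1.le hs
    simp only [fun θ => (hasSum_taylorCoeffZero hh (hmem θ)).tsum_eq] at hP
    refine (sum_le_hasSum _ (fun _ _ => by positivity) hP).trans ?_
    have := pi_pos
    gcongr
    have hc : Continuous fun θ => h (circleMap 0 r θ) :=
      hh.continuousOn.comp_continuous (continuous_circleMap 0 r) hmem
    refine intervalIntegral.integral_mono_on (by linarith) ((hc.norm.pow 2).intervalIntegrable _ _)
      ((cont_Q.comp (Continuous.prodMk_right r)).intervalIntegrable _ _) fun θ _ => hQ _ (hmem θ)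
  have hcont := intervalIntegral.continuous_parametric_intervalIntegral_of_continuous'
    (μ := MeasureTheory.volume) (f := fun r θ => ‖Q.eval (circleMap 0 r θ)‖) cont_Q (-π) π
  have h1 : Tendsto (fun r : ℝ => ∑ n ∈ Finset.range N, (r ^ n * ‖taylorCoeffZero h n‖) ^ 2)
      (𝓝[<] 1) (𝓝 (∑ n ∈ Finset.range N, (1 ^ n * ‖taylorCoeffZero h n‖) ^ 2)) :=
    (Continuous.tendsto (by fun_prop) 1).mono_left nhdsWithin_le_nhds
  have h2 := ((hcont.const_mul (1 / (2 * π))).tendsto 1).mono_left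
    (nhdsWithin_le_nhds (s := Set.Iio 1))
  simp only [one_pow, one_mul] at h1
  exact le_of_tendsto_of_tendsto h1 h2
    (eventually_of_mem (Ioo_mem_nhdsLT one_pos) hle)

theorem polynomial_riesz_factorization (P : ℂ[X]) : ∃ u v : ℕ → ℂ,
    (∀ N, ∑ n ∈ Finset.range N, ‖u n‖ ^ 2 ≤
      (1 / (2 * π)) * ∫ θ in (-π)..π, ‖P.eval (circleMap 0 1 θ)‖) ∧
    (∀ N, ∑ n ∈ Finset.range N, ‖v n‖ ^ 2 ≤
      (1 / (2 * π)) * ∫ θ in (-π)..π, ‖P.eval (circleMap 0 1 θ)‖) ∧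
    ∀ n, P.coeff n = ∑ k ∈ Finset.range (n + 1), u k * v (n - k) := by
  obtain ⟨B, g, Q, hB, hg, hB1, hP, hQ, hc⟩ := exists_inner_outer P
  have hPQ (θ : ℝ) : ‖P.eval (circleMap 0 1 θ)‖ = ‖Q.eval (circleMap 0 1 θ)‖ :=
    (hc _ (by simp)).symm
  simp only [hPQ]
  have hBg : DifferentiableOn ℂ (fun z => B z * g z) (ball 0 1) := hB.mul hg
  refine ⟨taylorCoeffZero fun z => B z * g z, taylorCoeffZero g,
    sum_sq_taylorCoeffZero_le hBg Q fun z hz => ?_,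
    sum_sq_taylorCoeffZero_le hg Q fun z hz => ?_, fun n => ?_⟩
  · rw [hQ z hz, norm_pow, norm_mul]
    gcongr
    exact mul_le_of_le_one_left (norm_nonneg _) (hB1 z hz)
  · rw [hQ z hz, norm_pow]
  · rw [← taylorCoeffZero_mul hBg hg, ← taylorCoeffZero_polynomial, taylorCoeffZero,
      taylorCoeffZero]
    congr 1
    refine Filter.EventuallyEq.iteratedDeriv_eq n ?_
    filter_upwards [ball_mem_nhds (0 : ℂ) one_pos] with z hz
    rw [hP z hz]
    ring

end RieszFactorization

section WeakFactorization

open Real Polynomial Filter Topology Metric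

/-- **Riesz factorization** `H¹ = H² · H²` on the complex unit disc, in terms of coefficients. -/
theorem exists_sq_summable_convolution {a : ℕ → ℂ}
    (ha : ∀ r : ℝ, 0 ≤ r → r < 1 → Summable fun n => r ^ n * ‖a n‖) {M : ℝ}
    (hM : ∀ r : ℝ, 0 < r → r < 1 →
      (1 / (2 * π)) * ∫ θ in (-π)..π, ‖∑' n : ℕ, circleMap 0 r θ ^ n * a n‖ ≤ M) :
    ∃ u v : ℕ → ℂ, (Summable fun n => ‖u n‖ ^ 2) ∧ (Summable fun n => ‖v n‖ ^ 2) ∧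
      ∀ n, a n = ∑ k ∈ Finset.range (n + 1), u k * v (n - k) := by
  obtain ⟨r, -, hr, hr1⟩ := exists_seq_strictMono_tendsto' (zero_lt_one (α := ℝ))
  have hs (k : ℕ) := ha (r k) (hr k).1.le (hr k).2
  have hN (k : ℕ) : ∃ N ≥ k, ∀ θ : ℝ,
      ‖∑ n ∈ Finset.range N, circleMap 0 (r k) θ ^ n * a n‖ ≤
        ‖∑' n : ℕ, circleMap 0 (r k) θ ^ n * a n‖ + 1 := by
    have hu := tendstoUniformly_tsum_nat (hs k)
      (f := fun n (θ : ℝ) => circleMap 0 (r k) θ ^ n * a n)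
      (fun n θ => by simp [abs_of_pos (hr k).1])
    rw [Metric.tendstoUniformly_iff] at hu
    obtain ⟨N, hN, hNk⟩ := ((hu 1 one_pos).and (eventually_ge_atTop k)).exists
    refine ⟨N, hNk, fun θ => ?_⟩
    have h1 := hN θ
    rw [dist_eq_norm_sub'] at h1
    have h2 := norm_le_norm_add_norm_sub'
      (∑ n ∈ Finset.range N, circleMap 0 (r k) θ ^ n * a n)
      (∑' n : ℕ, circleMap 0 (r k) θ ^ n * a n)
    linarith
  choose N hNk hN using hN
  set P : ℕ → ℂ[X] := fun k => ∑ n ∈ Finset.range (N k), C ((r k : ℂ) ^ n * a n) * X ^ n with hP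
  have hPeval (k : ℕ) (θ : ℝ) : (P k).eval (circleMap 0 1 θ) =
      ∑ n ∈ Finset.range (N k), circleMap 0 (r k) θ ^ n * a n := by
    simp only [hP, eval_finsetSum, eval_mul, eval_C, eval_pow, eval_X]
    refine Finset.sum_congr rfl fun n _ => ?_
    simp only [circleMap_zero, Complex.ofReal_one, one_mul, mul_pow]
    ring
  have hPcoeff (k n : ℕ) (hn : n < k) : (P k).coeff n = (r k : ℂ) ^ n * a n := by
    simp only [hP, finsetSum_coeff, coeff_C_mul_X_pow]
    rw [Finset.sum_ite_eq, if_pos (Finset.mem_range.2 (hn.trans_le (hNk k)))]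
  have hPmean (k : ℕ) :
      (1 / (2 * π)) * ∫ θ in (-π)..π, ‖(P k).eval (circleMap 0 1 θ)‖ ≤ M + 1 := by
    have hcont : Continuous fun θ : ℝ => ∑' n : ℕ, circleMap 0 (r k) θ ^ n * a n :=
      continuous_tsum (fun n => by fun_prop) (hs k)
        (fun n θ => by simp [abs_of_pos (hr k).1])
    have hle : ∫ θ in (-π)..π, ‖(P k).eval (circleMap 0 1 θ)‖ ≤
        ∫ θ in (-π)..π, (‖∑' n : ℕ, circleMap 0 (r k) θ ^ n * a n‖ + 1) := by
      refine intervalIntegral.integral_mono_on (by linarith [pi_pos]) ?_ ?_ fun θ _ => ?_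
      · apply Continuous.intervalIntegrable; fun_prop
      · apply Continuous.intervalIntegrable; fun_prop
      · rw [hPeval]; exact hN k θ
    rw [intervalIntegral.integral_add (hcont.norm.intervalIntegrable _ _) (by simp),
      intervalIntegral.integral_const] at hle
    have hpos := pi_pos
    have h := hM (r k) (hr k).1 (hr k).2
    calc _ ≤ (1 / (2 * π)) * ((∫ θ in (-π)..π, ‖∑' n : ℕ, circleMap 0 (r k) θ ^ n * a n‖) +
          (π - -π) • (1 : ℝ)) := by gcongr
      _ = (1 / (2 * π)) * (∫ θ in (-π)..π, ‖∑' n : ℕ, circleMap 0 (r k) θ ^ n * a n‖) + 1 := by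
          simp only [smul_eq_mul]; field_simp; ring
      _ ≤ M + 1 := by gcongr
  choose u v hu hv huv using fun k => polynomial_riesz_factorization (P k)
  have limit (w : ℕ → ℕ → ℂ) (hw : ∀ k N, ∑ n ∈ Finset.range N, ‖w k n‖ ^ 2 ≤ M + 1) :
      ∃ W : ℕ → ℂ, (Summable fun n => ‖W n‖ ^ 2) ∧
        ∀ n, Tendsto (fun k => w k n) (hyperfilter ℕ) (𝓝 (W n)) := by
    have hb (k n : ℕ) : w k n ∈ closedBall (0 : ℂ) √(M + 1) := by
      rw [mem_closedBall_zero_iff]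
      refine Real.le_sqrt_of_sq_le (le_trans ?_ (hw k (n + 1)))
      exact Finset.single_le_sum (f := fun n => ‖w k n‖ ^ 2) (fun _ _ => by positivity)
        (Finset.self_mem_range_succ n)
    have hlim (n : ℕ) : ∃ x, Tendsto (fun k => w k n) (hyperfilter ℕ) (𝓝 x) := by
      obtain ⟨x, -, hx⟩ := (isCompact_closedBall (0 : ℂ) √(M + 1)).ultrafilter_le_nhds
        ((hyperfilter ℕ).map fun k => w k n)
        (tendsto_principal.2 (Eventually.of_forall fun k => hb k n))
      exact ⟨x, hx⟩
    choose W hW using hlim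
    refine ⟨W, summable_of_sum_range_le (c := M + 1) (fun _ => by positivity) fun m => ?_, hW⟩
    exact le_of_tendsto (tendsto_finsetSum _ fun n _ => ((hW n).norm.pow 2))
      (Eventually.of_forall fun k => hw k m)
  obtain ⟨U, hU, hUlim⟩ := limit u fun k m => (hu k m).trans (hPmean k)
  obtain ⟨V, hV, hVlim⟩ := limit v fun k m => (hv k m).trans (hPmean k)
  refine ⟨U, V, hU, hV, fun n => ?_⟩
  have h1 : Tendsto (fun k => (P k).coeff n) (hyperfilter ℕ)
      (𝓝 (∑ k ∈ Finset.range (n + 1), U k * V (n - k))) := by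
    simp only [huv]
    exact tendsto_finsetSum _ fun j _ => (hUlim j).mul (hVlim (n - j))
  have h2 : Tendsto (fun k => (P k).coeff n) atTop (𝓝 (a n)) := by
    have : Tendsto (fun k => ((r k : ℝ) : ℂ) ^ n * a n) atTop (𝓝 (((1 : ℝ) : ℂ) ^ n * a n)) :=
      (((Complex.continuous_ofReal.tendsto 1).comp hr1).pow n).mul_const _
    simp only [Complex.ofReal_one, one_pow, one_mul] at this
    refine this.congr' ?_
    filter_upwards [eventually_gt_atTop n] with k hk
    rw [hPcoeff k n hk]
  refine tendsto_nhds_unique (h2.mono_left ?_) h1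
  rw [← Nat.cofinite_eq_atTop]
  exact hyperfilter_le_cofinite

/-- Coefficientwise complex-linear images of an `H¹` function belong to the complex `H¹`. -/
theorem exists_sq_summable_convolution_of_memH1 {f : ℕ → ℍ[ℝ]}
    (hconv : ∀ r : ℝ, 0 ≤ r → r < 1 → Summable fun n => r ^ n * ‖f n‖) (hf : MemH1 f)
    (p : ℍ[ℝ] →L[ℝ] ℂ) (hp : ∀ (z : ℂ) (q : ℍ[ℝ]), p (z * q) = z * p q) (hp1 : ∀ q, ‖p q‖ ≤ ‖q‖) :
    ∃ u v : ℕ → ℂ, (Summable fun n => ‖u n‖ ^ 2) ∧ (Summable fun n => ‖v n‖ ^ 2) ∧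
      ∀ n, p (f n) = ∑ k ∈ Finset.range (n + 1), u k * v (n - k) := by
  obtain ⟨M, hM⟩ := hf
  set I : ℍ[ℝ] := ((Complex.I : ℂ) : ℍ[ℝ]) with hIdef
  have hre : I.re = 0 := by simp [hIdef]
  have hI : ‖I‖ = 1 := by
    have : ‖I‖ * ‖I‖ = 1 := by
      rw [← Quaternion.normSq_eq_norm_mul_self, Quaternion.normSq_def']; simp [hIdef]
    nlinarith [norm_nonneg I]
  have hconv' (r : ℝ) (hr : 0 ≤ r) (hr1 : r < 1) : Summable fun n => r ^ n * ‖p (f n)‖ :=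
    .of_nonneg_of_le (fun n => by positivity) (fun n => by gcongr; exact hp1 _) (hconv r hr hr1)
  refine exists_sq_summable_convolution (a := fun n => p (f n)) hconv' (M := M)
    fun r hr hr1 => (le_trans ?_ (hM I hre hI r hr hr1))
  have hs := hconv r hr.le hr1
  have hexp (θ : ℝ) : r • expQ I θ = ((circleMap 0 r θ : ℂ) : ℍ[ℝ]) := by
    rw [circleMap_zero, Complex.exp_mul_I, ← Complex.ofReal_cos, ← Complex.ofReal_sin, expQ]
    ext <;> simp [hIdef]
    all_goals exact Or.inl rfl
  have hpow (z : ℂ) (n : ℕ) : ((z ^ n : ℂ) : ℍ[ℝ]) = (z : ℍ[ℝ]) ^ n :=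
    map_pow Quaternion.ofComplex z n
  have hsum (θ : ℝ) : ∑' n : ℕ, circleMap 0 r θ ^ n * p (f n) =
      p (∑' n : ℕ, (r • expQ I θ) ^ n * f n) := by
    rw [p.map_tsum (Summable.of_norm
      (by simpa only [norm_smul_expQ_pow_mul hre hI hr.le] using hs))]
    simp only [hexp, ← hpow, hp]
  have hc := continuous_tsum_slice hre hI hr.le hs
  have := pi_pos
  simp only [hsum]
  gcongr
  exact intervalIntegral.integral_mono_on (by linarith)
    ((p.continuous.comp hc).norm.intervalIntegrable _ _) (hc.norm.intervalIntegrable _ _)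
    fun θ _ => hp1 _

end WeakFactorization

theorem Quaternion.norm_coeComplex (z : ℂ) : ‖(z : ℍ[ℝ])‖ = ‖z‖ := by
  rw [← sq_eq_sq₀ (norm_nonneg _) (norm_nonneg _), sq, ← Quaternion.normSq_eq_norm_mul_self,
    Quaternion.normSq_def', ← Complex.normSq_eq_norm_sq, Complex.normSq_apply]
  simp [sq]

theorem sum_of_two_star_products_of_memH1 {f : ℕ → ℍ[ℝ]}
    (hconv : ∀ r : ℝ, 0 ≤ r → r < 1 → Summable fun n => r ^ n * ‖f n‖) (hf : MemH1 f) :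
    ∃ f₁ f₂ g₁ g₂ : ℕ → ℍ[ℝ],
      Summable (fun n => ‖f₁ n‖ ^ 2) ∧ Summable (fun n => ‖f₂ n‖ ^ 2) ∧
      Summable (fun n => ‖g₁ n‖ ^ 2) ∧ Summable (fun n => ‖g₂ n‖ ^ 2) ∧
      ∀ n : ℕ, f n = (∑ k ∈ Finset.range (n + 1), f₁ k * f₂ (n - k)) +
        (∑ k ∈ Finset.range (n + 1), g₁ k * g₂ (n - k)) := by
  let p₁ : ℍ[ℝ] →L[ℝ] ℂ := LinearMap.toContinuousLinearMap
    { toFun := fun q => ⟨q.re, q.imI⟩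
      map_add' := fun x y => by apply Complex.ext <;> simp
      map_smul' := fun c x => by apply Complex.ext <;> simp }
  let p₂ : ℍ[ℝ] →L[ℝ] ℂ := LinearMap.toContinuousLinearMap
    { toFun := fun q => ⟨q.imJ, q.imK⟩
      map_add' := fun x y => by apply Complex.ext <;> simp
      map_smul' := fun c x => by apply Complex.ext <;> simp }
  have p₁_apply (q : ℍ[ℝ]) : p₁ q = ⟨q.re, q.imI⟩ := rfl
  have p₂_apply (q : ℍ[ℝ]) : p₂ q = ⟨q.imJ, q.imK⟩ := rfl
  obtain ⟨u₁, v₁, hu₁, hv₁, h₁⟩ := exists_sq_summable_convolution_of_memH1 hconv hf p₁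
    (fun z q => by apply Complex.ext <;> simp [p₁_apply])
    (fun q => by
      rw [← sq_le_sq₀ (norm_nonneg _) (norm_nonneg _), sq ‖q‖, ← Quaternion.normSq_eq_norm_mul_self,
        Quaternion.normSq_def', ← Complex.normSq_eq_norm_sq, Complex.normSq_apply, p₁_apply]
      nlinarith [sq_nonneg q.imJ, sq_nonneg q.imK])
  obtain ⟨u₂, v₂, hu₂, hv₂, h₂⟩ := exists_sq_summable_convolution_of_memH1 hconv hf p₂
    (fun z q => by apply Complex.ext <;> simp [p₂_apply])
    (fun q => by
      rw [← sq_le_sq₀ (norm_nonneg _) (norm_nonneg _), sq ‖q‖, ← Quaternion.normSq_eq_norm_mul_self,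
        Quaternion.normSq_def', ← Complex.normSq_eq_norm_sq, Complex.normSq_apply, p₂_apply]
      nlinarith [sq_nonneg q.re, sq_nonneg q.imI])
  set j : ℍ[ℝ] := ⟨0, 0, 1, 0⟩
  have hj_re : j.re = 0 := rfl
  have hj_imI : j.imI = 0 := rfl
  have hj_imJ : j.imJ = 1 := rfl
  have hj_imK : j.imK = 0 := rfl
  have norm_j : ‖j‖ = 1 := by
    have : ‖j‖ * ‖j‖ = 1 := by
      rw [← Quaternion.normSq_eq_norm_mul_self, Quaternion.normSq_def']; simp [hj_re, hj_imI, hj_imJ, hj_imK]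
    nlinarith [norm_nonneg j]
  have decomp (q : ℍ[ℝ]) : q = (p₁ q : ℍ[ℝ]) + (p₂ q : ℍ[ℝ]) * j := by
    ext <;> simp [p₁_apply, p₂_apply, hj_re, hj_imI, hj_imJ, hj_imK]
  have coe_sum (u v : ℕ → ℂ) (n : ℕ) : ((∑ k ∈ Finset.range (n + 1), u k * v (n - k) : ℂ) : ℍ[ℝ]) =
      ∑ k ∈ Finset.range (n + 1), (u k : ℍ[ℝ]) * (v (n - k) : ℍ[ℝ]) := by
    rw [← Quaternion.coe_ofComplex, map_sum]
    simp only [map_mul]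
  refine ⟨fun n => u₁ n, fun n => v₁ n, fun n => u₂ n, fun n => v₂ n * j, ?_, ?_, ?_, ?_,
    fun n => ?_⟩
  · simpa only [Quaternion.norm_coeComplex] using hu₁
  · simpa only [Quaternion.norm_coeComplex] using hv₁
  · simpa only [Quaternion.norm_coeComplex] using hu₂
  · simpa only [norm_mul, norm_j, mul_one, Quaternion.norm_coeComplex] using hv₂
  · rw [decomp (f n), h₁, h₂, coe_sum, coe_sum, Finset.sum_mul]
    simp only [mul_assoc]

/-- **Weak factorization `H¹(𝔹) = H²(𝔹)⋆H²(𝔹) + H²(𝔹)⋆H²(𝔹)`.**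
A regular function `f(q) = ∑ₙ qⁿ f̌(n)` on `𝔹` belongs to `H¹(𝔹)` if and only if there
are four `ℓ²` coefficient sequences `f̌₁, f̌₂, ǧ₁, ǧ₂` with
`f̌(n) = ∑_{k=0}^{n} f̌₁(k)·f̌₂(n−k) + ∑_{k=0}^{n} ǧ₁(k)·ǧ₂(n−k)` for all `n`, i.e.
`f = f₁ ⋆ f₂ + g₁ ⋆ g₂` with `f₁, f₂, g₁, g₂ ∈ H²(𝔹)`. -/
theorem memH1_iff_sum_of_two_star_products (f : ℕ → ℍ[ℝ])
    (hconv : ∀ r : ℝ, 0 ≤ r → r < 1 → Summable fun n => r ^ n * ‖f n‖) :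
    MemH1 f ↔
    ∃ f₁ f₂ g₁ g₂ : ℕ → ℍ[ℝ],
      Summable (fun n => ‖f₁ n‖ ^ 2) ∧ Summable (fun n => ‖f₂ n‖ ^ 2) ∧
      Summable (fun n => ‖g₁ n‖ ^ 2) ∧ Summable (fun n => ‖g₂ n‖ ^ 2) ∧
      ∀ n : ℕ, f n = (∑ k ∈ Finset.range (n + 1), f₁ k * f₂ (n - k)) +
        (∑ k ∈ Finset.range (n + 1), g₁ k * g₂ (n - k)) := by
  refine ⟨sum_of_two_star_products_of_memH1 hconv, ?_⟩
  rintro ⟨f₁, f₂, g₁, g₂, hf₁, hf₂, hg₁, hg₂, h⟩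
  exact memH1_of_sum_of_two_star_products hf₁ hf₂ hg₁ hg₂ h
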